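/- arXiv:2504.08836 — 2 statements merged into one kernel-verified Lean document; each statement's English description precedes it below -/
import Mathlib

section
/- Let (Ω, 𝔉, P) be a probability space carrying random variables X (ℝ^p-valued), H (ℝ^q-valued), D ({0,1}-valued), and Y (real-valued, integrable). Let f*, f : {0,1} × ℝ^p × ℝ^q → ℝ and m*, m : ℝ^p → ℝ be measurable with f(d, X, H), f*(d, X, H) ∈ L¹(P) for d ∈ {0,1}, (m − m*)(X) · (f − f*)(D, X, H) ∈ L¹(P), and ζ ≤ m(X) ≤ 1−ζ and ζ ≤ m*(X) ≤ 1−ζ almost surely for some ζ ∈ (0, 1/2). Assume E[Y | D, X, H] = f*(D, X, H) almost surely. For r ∈ [0,1] write f_r = f* + r(f − f*), m_r = m* + r(m − m*), and g(r) := E[ f_r(1, X, H) − f_r(0, X, H) + (D/m_r(X) − (1−D)/(1−m_r(X))) · (Y − f_r(D, X, H)) ]. Then g is twice differentiable on (0,1) and for every r ∈ (0,1), |g″(r)| ≤ 2 ζ^{-3} E[ |(m − m*)(X)| · |(f − f*)(D, X, H)| ]. -/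
open MeasureTheory ProbabilityTheory Filter

noncomputable section

/-- A point on the segment between two numbers that are at least `ζ` is at least `ζ`. -/
theorem le_add_mul_of_mem_Ioo {ζ a b r : ℝ} (ha : ζ ≤ a) (hab : ζ ≤ a + b)
    (hr : r ∈ Set.Ioo (0 : ℝ) 1) : ζ ≤ a + r * b := by
  obtain ⟨h0, h1⟩ := hr
  nlinarith [mul_nonneg h0.le (sub_nonneg.2 hab), mul_nonneg (sub_nonneg.2 h1.le) (sub_nonneg.2 ha)]

theorem hasDerivAt_div_add_mul {a b r : ℝ} (h : a + r * b ≠ 0) :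
    HasDerivAt (fun t : ℝ => t / (a + t * b)) (a / (a + r * b) ^ 2) r := by
  have h1 : HasDerivAt (fun t : ℝ => a + t * b) b r := by
    simpa using ((hasDerivAt_id r).mul_const b).const_add a
  exact ((hasDerivAt_id' r).fun_div h1 h).congr_deriv (by ring)

theorem hasDerivAt_div_add_mul_sq {a b r : ℝ} (h : a + r * b ≠ 0) :
    HasDerivAt (fun t : ℝ => a / (a + t * b) ^ 2) (-(2 * a * b) / (a + r * b) ^ 3) r := by
  have h1 : HasDerivAt (fun t : ℝ => a + t * b) b r := by
    simpa using ((hasDerivAt_id r).mul_const b).const_add a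
  refine ((hasDerivAt_const r a).fun_div (h1.fun_pow 2) (pow_ne_zero 2 h)).congr_deriv ?_
  field_simp
  ring

theorem abs_div_pow_le {ζ a c : ℝ} (n : ℕ) (hζ : 0 < ζ) (hc : ζ ≤ c) :
    |a / c ^ n| ≤ |a| * ζ⁻¹ ^ n := by
  have hc0 : 0 < c := hζ.trans_le hc
  rw [abs_div, abs_of_pos (pow_pos hc0 n), div_eq_mul_inv, inv_pow]
  gcongr

section PathIntegral

variable {Ω : Type*} [MeasurableSpace Ω] {P : Measure Ω} {a b u : Ω → ℝ} {ζ r : ℝ}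

theorem hasDerivAt_integral_mul_div_add_mul (ha : Measurable a) (hb : Measurable b)
    (hu : Integrable u P) (hζ : 0 < ζ) (haζ : ∀ᵐ ω ∂P, ζ ≤ a ω ∧ a ω ≤ 1)
    (habζ : ∀ᵐ ω ∂P, ζ ≤ a ω + b ω) (hr : r ∈ Set.Ioo (0 : ℝ) 1) :
    HasDerivAt (fun t => ∫ ω, u ω * (t / (a ω + t * b ω)) ∂P)
      (∫ ω, u ω * (a ω / (a ω + r * b ω) ^ 2) ∂P) r := by
  have hum := hu.aestronglyMeasurable
  refine (hasDerivAt_integral_of_dominated_loc_of_deriv_le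
    (F' := fun t ω => u ω * (a ω / (a ω + t * b ω) ^ 2))
    (bound := fun ω => |u ω| * ζ⁻¹ ^ 2) (Ioo_mem_nhds hr.1 hr.2)
    (Eventually.of_forall fun t => hum.mul
      (by fun_prop : Measurable fun ω => t / (a ω + t * b ω)).aestronglyMeasurable)
    ?_ (hum.mul (by fun_prop : Measurable fun ω =>
      a ω / (a ω + r * b ω) ^ 2).aestronglyMeasurable) ?_ (hu.abs.mul_const _) ?_).2
  · refine hu.mul_bdd (c := |r| * ζ⁻¹ ^ 1) (by fun_prop : Measurable fun ω =>
      r / (a ω + r * b ω)).aestronglyMeasurable ?_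
    filter_upwards [haζ, habζ] with ω h1 h2
    simpa [abs_div] using abs_div_pow_le (a := r) 1 hζ (le_add_mul_of_mem_Ioo h1.1 h2 hr)
  · filter_upwards [haζ, habζ] with ω h1 h2 t ht
    rw [Real.norm_eq_abs, abs_mul]
    refine mul_le_mul_of_nonneg_left ((abs_div_pow_le 2 hζ
      (le_add_mul_of_mem_Ioo h1.1 h2 ht)).trans ?_) (abs_nonneg _)
    rw [abs_of_pos (hζ.trans_le h1.1)]
    exact mul_le_of_le_one_left (by positivity) h1.2
  · filter_upwards [haζ, habζ] with ω h1 h2 t ht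
    exact (hasDerivAt_div_add_mul
      (hζ.trans_le (le_add_mul_of_mem_Ioo h1.1 h2 ht)).ne').const_mul _

theorem abs_neg_two_mul_div_pow_le {a b c : ℝ} (hζ : 0 < ζ) (ha : ζ ≤ a ∧ a ≤ 1) (hc : ζ ≤ c) :
    |-(2 * a * b) / c ^ 3| ≤ 2 * ζ⁻¹ ^ 3 * |b| := by
  refine (abs_div_pow_le 3 hζ hc).trans ?_
  rw [abs_neg, abs_mul, abs_mul, abs_two, abs_of_pos (hζ.trans_le ha.1)]
  have : 0 ≤ |b| * ζ⁻¹ ^ 3 := by positivity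
  nlinarith [mul_le_of_le_one_left this ha.2]

theorem hasDerivAt_integral_mul_div_add_mul_sq (ha : Measurable a) (hb : Measurable b)
    (hu : Integrable u P) (hub : Integrable (fun ω => u ω * b ω) P) (hζ : 0 < ζ)
    (haζ : ∀ᵐ ω ∂P, ζ ≤ a ω ∧ a ω ≤ 1)
    (habζ : ∀ᵐ ω ∂P, ζ ≤ a ω + b ω) (hr : r ∈ Set.Ioo (0 : ℝ) 1) :
    HasDerivAt (fun t => ∫ ω, u ω * (a ω / (a ω + t * b ω) ^ 2) ∂P)
      (∫ ω, u ω * (-(2 * a ω * b ω) / (a ω + r * b ω) ^ 3) ∂P) r := by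
  have hum := hu.aestronglyMeasurable
  refine (hasDerivAt_integral_of_dominated_loc_of_deriv_le
    (F' := fun t ω => u ω * (-(2 * a ω * b ω) / (a ω + t * b ω) ^ 3))
    (bound := fun ω => 2 * ζ⁻¹ ^ 3 * |u ω * b ω|) (Ioo_mem_nhds hr.1 hr.2)
    (Eventually.of_forall fun t => hum.mul
      (by fun_prop : Measurable fun ω => a ω / (a ω + t * b ω) ^ 2).aestronglyMeasurable)
    ?_ (hum.mul (by fun_prop : Measurable fun ω =>
      -(2 * a ω * b ω) / (a ω + r * b ω) ^ 3).aestronglyMeasurable) ?_ (hub.abs.const_mul _) ?_).2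
  · refine hu.mul_bdd (c := ζ⁻¹ ^ 2) (by fun_prop : Measurable fun ω =>
      a ω / (a ω + r * b ω) ^ 2).aestronglyMeasurable ?_
    filter_upwards [haζ, habζ] with ω h1 h2
    refine (abs_div_pow_le 2 hζ (le_add_mul_of_mem_Ioo h1.1 h2 hr)).trans ?_
    rw [abs_of_pos (hζ.trans_le h1.1)]
    exact mul_le_of_le_one_left (by positivity) h1.2
  · filter_upwards [haζ, habζ] with ω h1 h2 t ht
    rw [Real.norm_eq_abs, abs_mul, abs_mul, mul_left_comm]
    exact mul_le_mul_of_nonneg_left (abs_neg_two_mul_div_pow_le hζ h1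
      (le_add_mul_of_mem_Ioo h1.1 h2 ht)) (abs_nonneg _)
  · filter_upwards [haζ, habζ] with ω h1 h2 t ht
    exact (hasDerivAt_div_add_mul_sq
      (hζ.trans_le (le_add_mul_of_mem_Ioo h1.1 h2 ht)).ne').const_mul _

theorem abs_integral_mul_div_add_mul_cube_le (hub : Integrable (fun ω => u ω * b ω) P) (hζ : 0 < ζ)
    (haζ : ∀ᵐ ω ∂P, ζ ≤ a ω ∧ a ω ≤ 1)
    (habζ : ∀ᵐ ω ∂P, ζ ≤ a ω + b ω) (hr : r ∈ Set.Ioo (0 : ℝ) 1) :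
    |∫ ω, u ω * (-(2 * a ω * b ω) / (a ω + r * b ω) ^ 3) ∂P| ≤
      2 * ζ⁻¹ ^ 3 * ∫ ω, |u ω * b ω| ∂P := by
  rw [← integral_const_mul, ← Real.norm_eq_abs]
  refine norm_integral_le_of_norm_le (hub.abs.const_mul _) ?_
  filter_upwards [haζ, habζ] with ω h1 h2
  rw [Real.norm_eq_abs, abs_mul, abs_mul, mul_left_comm]
  exact mul_le_mul_of_nonneg_left (abs_neg_two_mul_div_pow_le hζ h1
    (le_add_mul_of_mem_Ioo h1.1 h2 hr)) (abs_nonneg _)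

end PathIntegral

/-- A bounded weight measurable with respect to `m` does not distinguish `Y` from a version of its
conditional expectation given `m`. -/
theorem integral_mul_eq_integral_mul_of_condExp_ae_eq {Ω : Type*} {m m₀ : MeasurableSpace Ω}
    {P : Measure Ω} [IsFiniteMeasure P] (hm : m ≤ m₀) {w Y Z : Ω → ℝ} {c : ℝ} (hw : StronglyMeasurable[m] w)
    (hwc : ∀ᵐ ω ∂P, ‖w ω‖ ≤ c) (hY : Integrable Y P) (hYZ : P[Y | m] =ᵐ[P] Z) :
    ∫ ω, w ω * Y ω ∂P = ∫ ω, w ω * Z ω ∂P := by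
  have hwY : Integrable (w * Y) P := hY.bdd_mul (hw.mono hm).aestronglyMeasurable hwc
  calc ∫ ω, w ω * Y ω ∂P = ∫ ω, (P[w * Y | m]) ω ∂P := (integral_condExp hm).symm
    _ = ∫ ω, w ω * Z ω ∂P := by
      refine integral_congr_ae ?_
      filter_upwards [condExp_mul_of_stronglyMeasurable_left hw hwY hY, hYZ] with ω h1 h2
      rw [h1, Pi.mul_apply, h2]

/-- second-order bound for the shared-state AIPW score: along the path from
the true nuisances `(f*, m*)` to `(f, m)`, the expected score is twice differentiable on `(0,1)`
and its second derivative is bounded by `2 ζ⁻³ E[|(m−m*)(X)| · |(f−f*)(D,X,H)|]`. -/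
theorem stmt_8
    {Ω : Type*} [MeasurableSpace Ω] (P : Measure Ω) [IsProbabilityMeasure P]
    (p q : ℕ)
    (X : Ω → (Fin p → ℝ)) (H : Ω → (Fin q → ℝ)) (D : Ω → ℝ) (Y : Ω → ℝ)
    (hX : Measurable X) (hH : Measurable H) (hD : Measurable D) (hY : Measurable Y)
    (hDbin : ∀ ω, D ω = 0 ∨ D ω = 1)
    (hYint : Integrable Y P)
    (fstar f : ℝ → (Fin p → ℝ) → (Fin q → ℝ) → ℝ)
    (mstar m : (Fin p → ℝ) → ℝ)
    (hfmeas : Measurable (fun x : ℝ × (Fin p → ℝ) × (Fin q → ℝ) => f x.1 x.2.1 x.2.2))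
    (hfstarmeas : Measurable (fun x : ℝ × (Fin p → ℝ) × (Fin q → ℝ) => fstar x.1 x.2.1 x.2.2))
    (hmmeas : Measurable m) (hmstarmeas : Measurable mstar)
    (hfL1 : ∀ d : ℝ, d = 0 ∨ d = 1 →
      Integrable (fun ω => f d (X ω) (H ω)) P ∧ Integrable (fun ω => fstar d (X ω) (H ω)) P)
    (hprodL1 : Integrable (fun ω =>
      (m (X ω) - mstar (X ω)) * (f (D ω) (X ω) (H ω) - fstar (D ω) (X ω) (H ω))) P)
    (ζ : ℝ) (hζ : ζ ∈ Set.Ioo (0 : ℝ) (1/2))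
    (hmbound : ∀ᵐ ω ∂P, ζ ≤ m (X ω) ∧ m (X ω) ≤ 1 - ζ)
    (hmstarbound : ∀ᵐ ω ∂P, ζ ≤ mstar (X ω) ∧ mstar (X ω) ≤ 1 - ζ)
    -- outcome regression: E[Y | D, X, H] = f*(D, X, H) a.s.
    (hreg : P[Y | MeasurableSpace.comap (fun ω => (D ω, X ω, H ω)) inferInstance]
      =ᵐ[P] fun ω => fstar (D ω) (X ω) (H ω))
    (g : ℝ → ℝ)
    (hg : ∀ r : ℝ, g r = ∫ ω,
      ((fstar 1 (X ω) (H ω) + r * (f 1 (X ω) (H ω) - fstar 1 (X ω) (H ω))) -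
        (fstar 0 (X ω) (H ω) + r * (f 0 (X ω) (H ω) - fstar 0 (X ω) (H ω))) +
        (D ω / (mstar (X ω) + r * (m (X ω) - mstar (X ω))) -
          (1 - D ω) / (1 - (mstar (X ω) + r * (m (X ω) - mstar (X ω))))) *
          (Y ω - (fstar (D ω) (X ω) (H ω) +
            r * (f (D ω) (X ω) (H ω) - fstar (D ω) (X ω) (H ω))))) ∂P) :
    ∀ r ∈ Set.Ioo (0 : ℝ) 1,
      DifferentiableAt ℝ g r ∧ DifferentiableAt ℝ (deriv g) r ∧
      |deriv (deriv g) r| ≤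
        2 * ζ⁻¹ ^ 3 *
          ∫ ω, |m (X ω) - mstar (X ω)| * |f (D ω) (X ω) (H ω) - fstar (D ω) (X ω) (H ω)| ∂P := by
  obtain ⟨hζ0, -⟩ := hζ
  set s : Ω → ℝ := fun ω => 2 * D ω - 1 with hs
  set a : Ω → ℝ := fun ω => D ω * mstar (X ω) + (1 - D ω) * (1 - mstar (X ω)) with ha
  set b : Ω → ℝ := fun ω => s ω * (m (X ω) - mstar (X ω)) with hb
  set δ : Ω → ℝ := fun ω => f (D ω) (X ω) (H ω) - fstar (D ω) (X ω) (H ω) with hδ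
  set u : Ω → ℝ := fun ω => s ω * δ ω with hu
  have ham : Measurable a := by fun_prop
  have hbm : Measurable b := by fun_prop
  have hselect : ∀ φ : ℝ → (Fin p → ℝ) → (Fin q → ℝ) → ℝ,
      (∀ d : ℝ, d = 0 ∨ d = 1 → Integrable (fun ω => φ d (X ω) (H ω)) P) →
      Integrable (fun ω => φ (D ω) (X ω) (H ω)) P := by
    intro φ hφ
    have hD1 : ∀ᵐ ω ∂P, ‖D ω‖ ≤ 1 := Eventually.of_forall fun ω => by
      rcases hDbin ω with h | h <;> simp [h]
    have hD0 : ∀ᵐ ω ∂P, ‖1 - D ω‖ ≤ 1 := Eventually.of_forall fun ω => by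
      rcases hDbin ω with h | h <;> simp [h]
    refine (((hφ 1 (.inr rfl)).bdd_mul hD.aestronglyMeasurable hD1).add
      ((hφ 0 (.inl rfl)).bdd_mul (measurable_const.sub hD).aestronglyMeasurable hD0)).congr
      (Eventually.of_forall fun ω => ?_)
    rcases hDbin ω with h | h <;> simp [h]
  have hfs : Integrable (fun ω => fstar (D ω) (X ω) (H ω)) P :=
    hselect fstar fun d hd => (hfL1 d hd).2
  have hδi : Integrable δ P := (hselect f fun d hd => (hfL1 d hd).1).sub hfs
  have hui : Integrable u P := by
    refine hδi.bdd_mul (c := 1) (by fun_prop : Measurable s).aestronglyMeasurable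
      (Eventually.of_forall fun ω => ?_)
    rcases hDbin ω with h | h <;> norm_num [hs, h]
  have hub_eq : ∀ ω, u ω * b ω = (m (X ω) - mstar (X ω)) * δ ω := by
    intro ω
    rcases hDbin ω with h | h <;> simp only [hu, hb, hs, h] <;> ring
  have hub : Integrable (fun ω => u ω * b ω) P := by simpa only [hub_eq] using hprodL1
  have haζ : ∀ᵐ ω ∂P, ζ ≤ a ω ∧ a ω ≤ 1 := by
    filter_upwards [hmstarbound] with ω h1
    rcases hDbin ω with h | h <;> simp only [ha, h] <;> constructor <;> linarith [h1.1, h1.2]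
  have habζ : ∀ᵐ ω ∂P, ζ ≤ a ω + b ω := by
    filter_upwards [hmbound] with ω h1
    rcases hDbin ω with h | h <;> simp only [ha, hb, hs, h] <;> linarith [h1.1, h1.2]
  have hgeq : ∀ r ∈ Set.Ioo (0 : ℝ) 1, g r =
      (∫ ω, (fstar 1 (X ω) (H ω) - fstar 0 (X ω) (H ω)) ∂P) +
      r * (∫ ω, ((f 1 (X ω) (H ω) - fstar 1 (X ω) (H ω)) -
        (f 0 (X ω) (H ω) - fstar 0 (X ω) (H ω))) ∂P) -
      ∫ ω, u ω * (r / (a ω + r * b ω)) ∂P := by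
    intro r hr
    obtain ⟨hf0, hfs0⟩ := hfL1 0 (.inl rfl)
    obtain ⟨hf1, hfs1⟩ := hfL1 1 (.inr rfl)
    set w : Ω → ℝ := fun ω => s ω / (a ω + r * b ω) with hw
    have hwc : ∀ᵐ ω ∂P, ‖w ω‖ ≤ ζ⁻¹ := by
      filter_upwards [haζ, habζ] with ω h1 h2
      have h3 := abs_div_pow_le (a := s ω) 1 hζ0 (le_add_mul_of_mem_Ioo h1.1 h2 hr)
      have h4 : |s ω| = 1 := by rcases hDbin ω with h | h <;> norm_num [hs, h]
      simpa [h4] using h3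
    have hT : Measurable fun ω => (D ω, X ω, H ω) := hD.prodMk (hX.prodMk hH)
    have hwm : StronglyMeasurable[MeasurableSpace.comap (fun ω => (D ω, X ω, H ω)) inferInstance]
        w := by
      have hψ : Measurable fun z : ℝ × (Fin p → ℝ) × (Fin q → ℝ) =>
          (2 * z.1 - 1) / ((z.1 * mstar z.2.1 + (1 - z.1) * (1 - mstar z.2.1)) +
            r * ((2 * z.1 - 1) * (m z.2.1 - mstar z.2.1))) := by fun_prop
      exact (hψ.comp (comap_measurable fun ω => (D ω, X ω, H ω))).stronglyMeasurable
    have hwm' := (hwm.mono hT.comap_le).aestronglyMeasurable (μ := P)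
    have hwY : Integrable (fun ω => w ω * Y ω) P := hYint.bdd_mul hwm' hwc
    have hwf : Integrable (fun ω => w ω * fstar (D ω) (X ω) (H ω)) P := hfs.bdd_mul hwm' hwc
    have hwδ : Integrable (fun ω => u ω * (r / (a ω + r * b ω))) P :=
      ((hδi.bdd_mul hwm' hwc).const_mul r).congr
        (Eventually.of_forall fun ω => by simp only [hw, hu]; ring)
    have hzero := integral_mul_eq_integral_mul_of_condExp_ae_eq hT.comap_le hwm hwc hYint hreg
    set A : Ω → ℝ := fun ω => fstar 1 (X ω) (H ω) - fstar 0 (X ω) (H ω) with hA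
    set B : Ω → ℝ := fun ω => (f 1 (X ω) (H ω) - fstar 1 (X ω) (H ω)) -
      (f 0 (X ω) (H ω) - fstar 0 (X ω) (H ω)) with hB
    have hAi : Integrable A P := hfs1.sub hfs0
    have hBi : Integrable (fun ω => r * B ω) P :=
      ((hf1.sub hfs1).sub (hf0.sub hfs0)).const_mul r
    have hABi : Integrable (fun ω => A ω + r * B ω) P := hAi.add hBi
    have hABui : Integrable (fun ω => A ω + r * B ω - u ω * (r / (a ω + r * b ω))) P :=
      hABi.sub hwδ
    have hWi : Integrable (fun ω => w ω * Y ω - w ω * fstar (D ω) (X ω) (H ω)) P := hwY.sub hwf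
    have hW : ∫ ω, (w ω * Y ω - w ω * fstar (D ω) (X ω) (H ω)) ∂P = 0 := by
      rw [integral_sub hwY hwf, hzero, sub_self]
    rw [hg r, ← integral_const_mul, ← integral_add hAi hBi, ← integral_sub hABi hwδ]
    refine Eq.trans ?_ ((integral_add hABui hWi).trans (by rw [hW, add_zero]))
    refine integral_congr_ae (Eventually.of_forall fun ω => ?_)
    rcases hDbin ω with h | h <;> simp only [hA, hB, hw, hu, hδ, ha, hb, hs, h]
    · rw [show 1 - (mstar (X ω) + r * (m (X ω) - mstar (X ω))) =
        0 * mstar (X ω) + (1 - 0) * (1 - mstar (X ω)) +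
          r * ((2 * 0 - 1) * (m (X ω) - mstar (X ω))) by ring]
      ring
    · rw [show 1 * mstar (X ω) + (1 - 1) * (1 - mstar (X ω)) +
          r * ((2 * 1 - 1) * (m (X ω) - mstar (X ω))) =
        mstar (X ω) + r * (m (X ω) - mstar (X ω)) by ring]
      ring
  set C : ℝ := ∫ ω, ((f 1 (X ω) (H ω) - fstar 1 (X ω) (H ω)) -
    (f 0 (X ω) (H ω) - fstar 0 (X ω) (H ω))) ∂P
  have hd1 : ∀ r ∈ Set.Ioo (0 : ℝ) 1,
      HasDerivAt g (C - ∫ ω, u ω * (a ω / (a ω + r * b ω) ^ 2) ∂P) r := by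
    intro r hr
    have hlin : HasDerivAt (fun t : ℝ => t * C) C r := by
      simpa using (hasDerivAt_id r).mul_const C
    exact ((hlin.const_add _).sub (hasDerivAt_integral_mul_div_add_mul ham hbm hui hζ0 haζ habζ
      hr)).congr_of_eventuallyEq (eventually_of_mem (Ioo_mem_nhds hr.1 hr.2) hgeq)
  intro r hr
  have hd2 : HasDerivAt (deriv g)
      (-∫ ω, u ω * (-(2 * a ω * b ω) / (a ω + r * b ω) ^ 3) ∂P) r :=
    ((hasDerivAt_integral_mul_div_add_mul_sq ham hbm hui hub hζ0 haζ habζ hr).const_sub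
      C).congr_of_eventuallyEq
      (eventually_of_mem (Ioo_mem_nhds hr.1 hr.2) fun t ht => (hd1 t ht).deriv)
  refine ⟨(hd1 r hr).differentiableAt, hd2.differentiableAt, ?_⟩
  rw [hd2.deriv, abs_neg]
  simpa only [hub_eq, abs_mul] using abs_integral_mul_div_add_mul_cube_le hub hζ0 haζ habζ hr
end
end

section
/- Fix m ∈ ℕ and ζ ∈ (0, 1/2). Let (Ω, 𝔉, P) be a probability space carrying: covariates X ∈ ℝ^p, past covariates X⁻ ∈ ℝ^{pm}, a treatment window D = (D_{−m}, …, D_0) ∈ {0,1}^{m+1} with current treatment D_0, and an outcome Y ∈ ℝ. Let H : {0,1}^m × ℝ^{pm} → ℝ^q be measurable with observed shared state H_obs = H((D_{−m},…,D_{−1}), X⁻), let π₁ = P(D = (1,…,1)) ≥ ζ and π₀ = P(D = (0,…,0)) ≥ ζ, and let f*, f : {0,1} × ℝ^p × ℝ^q → ℝ be measurable with f(d, X, H(b, X⁻)), f*(d, X, H(b, X⁻)) ∈ L¹(P) for all d ∈ {0,1} and b ∈ {(1,…,1),(0,…,0),(D_{−m},…,D_{−1})}, and Y ∈ L¹(P).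 Assume D is independent of (X, X⁻), and E[Y | D, X, X⁻] = f*(D_0, X, H_obs) almost surely. For r ∈ [0,1] write f_r = f* + r(f − f*) and define g(r) := E[ f_r(1, X, H((1,…,1), X⁻)) − f_r(0, X, H((0,…,0), X⁻)) + (1{D = (1,…,1)}/π₁ − 1{D = (0,…,0)}/π₀) · (Y − f_r(D_0, X, H_obs)) ]. Then g is constant on [0,1]; in particular g′(0) = 0 (Neyman orthogonality) and g″(r) = 0 for all r ∈ (0,1). -/
open MeasureTheory ProbabilityTheory Filter

noncomputable section

/-- Inverse-probability weighting by an event of an independent variable preserves integrals. -/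
lemma integral_indicator_div_mul_of_indepFun {Ω α β : Type*} [MeasurableSpace Ω]
    [MeasurableSpace α] [MeasurableSpace β] {P : Measure Ω} {D : Ω → α} {Z : Ω → β}
    (hD : Measurable D) (hZ : Measurable Z) (hindep : IndepFun D Z P)
    {S : Set α} (hS : MeasurableSet S) (hPS : P.real (D ⁻¹' S) ≠ 0)
    {h : β → ℝ} (hh : Measurable h) :
    ∫ ω, (D ⁻¹' S).indicator (fun _ => (1 : ℝ)) ω / P.real (D ⁻¹' S) * h (Z ω) ∂P
      = ∫ ω, h (Z ω) ∂P := by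
  have hind : Measurable (S.indicator fun _ => (1 : ℝ)) := measurable_const.indicator hS
  have hmul := (hindep.comp hind hh).integral_mul_eq_mul_integral
    (hind.comp hD).aestronglyMeasurable (hh.comp hZ).aestronglyMeasurable
  have hcomp : (S.indicator fun _ => (1 : ℝ)) ∘ D = (D ⁻¹' S).indicator fun _ => 1 := rfl
  have hprob : ∫ ω, (D ⁻¹' S).indicator (fun _ => (1 : ℝ)) ω ∂P = P.real (D ⁻¹' S) :=
    integral_indicator_one (hD hS)
  rw [hcomp, hprob] at hmul
  simp only [div_mul_eq_mul_div, integral_div]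
  rw [div_eq_iff hPS, mul_comm (∫ ω, h (Z ω) ∂P)]
  exact hmul

/-- Multiplying by a scaled indicator of a measurable set preserves integrability. -/
lemma MeasureTheory.Integrable.indicator_div_mul {Ω : Type*} [MeasurableSpace Ω] {P : Measure Ω}
    {A : Set Ω} (hA : MeasurableSet A) (c : ℝ) {u : Ω → ℝ} (hu : Integrable u P) :
    Integrable (fun ω => A.indicator (fun _ => (1 : ℝ)) ω / c * u ω) P := by
  refine ((hu.indicator hA).div_const c).congr (.of_forall fun ω => ?_)
  by_cases hω : ω ∈ A <;> simp [hω, div_eq_inv_mul]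

/-- Neyman orthogonality of the switchback (GATE) score: along the path from
the true outcome regression `f*` to any `f`, the expected score is constant on `[0,1]`;
in particular its derivative vanishes at `0` and its second derivative vanishes on `(0,1)`. -/
theorem stmt_10
    {Ω : Type*} [MeasurableSpace Ω] (P : Measure Ω) [IsProbabilityMeasure P]
    (m p q : ℕ) (ζ : ℝ) (hζ : ζ ∈ Set.Ioo (0 : ℝ) (1/2))
    (X : Ω → (Fin p → ℝ)) (Xm : Ω → (Fin m → Fin p → ℝ))
    (D : Ω → (Fin (m + 1) → ℝ)) (Y : Ω → ℝ)
    (hX : Measurable X) (hXm : Measurable Xm) (hD : Measurable D) (hY : Measurable Y)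
    (hDbin : ∀ ω i, D ω i = 0 ∨ D ω i = 1)
    (hYint : Integrable Y P)
    (H : (Fin m → ℝ) → (Fin m → Fin p → ℝ) → (Fin q → ℝ))
    (hHmeas : Measurable (fun x : (Fin m → ℝ) × (Fin m → Fin p → ℝ) => H x.1 x.2))
    (Hobs : Ω → (Fin q → ℝ))
    (hHobs : ∀ ω, Hobs ω = H (fun i => D ω i.castSucc) (Xm ω))
    (π₁ π₀ : ℝ)
    (hπ₁ : π₁ = (P {ω | ∀ i, D ω i = 1}).toReal) (hπ₁ζ : ζ ≤ π₁)
    (hπ₀ : π₀ = (P {ω | ∀ i, D ω i = 0}).toReal) (hπ₀ζ : ζ ≤ π₀)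
    (fstar f : ℝ → (Fin p → ℝ) → (Fin q → ℝ) → ℝ)
    (hfmeas : Measurable (fun x : ℝ × (Fin p → ℝ) × (Fin q → ℝ) => f x.1 x.2.1 x.2.2))
    (hfstarmeas : Measurable (fun x : ℝ × (Fin p → ℝ) × (Fin q → ℝ) => fstar x.1 x.2.1 x.2.2))
    -- integrability of the relevant evaluations
    (hfL1 : ∀ d : ℝ, d = 0 ∨ d = 1 →
      Integrable (fun ω => f d (X ω) (H (fun _ => 1) (Xm ω))) P ∧
      Integrable (fun ω => f d (X ω) (H (fun _ => 0) (Xm ω))) P ∧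
      Integrable (fun ω => f d (X ω) (Hobs ω)) P ∧
      Integrable (fun ω => fstar d (X ω) (H (fun _ => 1) (Xm ω))) P ∧
      Integrable (fun ω => fstar d (X ω) (H (fun _ => 0) (Xm ω))) P ∧
      Integrable (fun ω => fstar d (X ω) (Hobs ω)) P)
    -- the treatment window is independent of the covariates
    (hindep : IndepFun D (fun ω => (X ω, Xm ω)) P)
    -- outcome regression: E[Y | D, X, X⁻] = f*(D₀, X, H_obs) a.s.
    (hreg : P[Y | MeasurableSpace.comap (fun ω => (D ω, X ω, Xm ω)) inferInstance]
      =ᵐ[P] fun ω => fstar (D ω (Fin.last m)) (X ω) (Hobs ω))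
    (g : ℝ → ℝ)
    (hg : ∀ r : ℝ, g r = ∫ ω,
      ((fstar 1 (X ω) (H (fun _ => 1) (Xm ω)) +
          r * (f 1 (X ω) (H (fun _ => 1) (Xm ω)) - fstar 1 (X ω) (H (fun _ => 1) (Xm ω)))) -
        (fstar 0 (X ω) (H (fun _ => 0) (Xm ω)) +
          r * (f 0 (X ω) (H (fun _ => 0) (Xm ω)) - fstar 0 (X ω) (H (fun _ => 0) (Xm ω)))) +
        (Set.indicator {ω' | ∀ i, D ω' i = 1} (fun _ => (1 : ℝ)) ω / π₁ -
          Set.indicator {ω' | ∀ i, D ω' i = 0} (fun _ => (1 : ℝ)) ω / π₀) *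
          (Y ω - (fstar (D ω (Fin.last m)) (X ω) (Hobs ω) +
            r * (f (D ω (Fin.last m)) (X ω) (Hobs ω) -
              fstar (D ω (Fin.last m)) (X ω) (Hobs ω))))) ∂P) :
    (∀ r ∈ Set.Icc (0 : ℝ) 1, ∀ s ∈ Set.Icc (0 : ℝ) 1, g r = g s) ∧
    deriv g 0 = 0 ∧ ∀ r ∈ Set.Ioo (0 : ℝ) 1, deriv (deriv g) r = 0 := by
  set Z : Ω → (Fin p → ℝ) × (Fin m → Fin p → ℝ) := fun ω => (X ω, Xm ω)
  have hZ : Measurable Z := hX.prodMk hXm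
  have hset : ∀ c : ℝ, {ω | ∀ i, D ω i = c} = D ⁻¹' {fun _ => c} := fun c => by
    ext ω
    simp [funext_iff]
  rw [hset] at hπ₁ hπ₀
  simp only [hset] at hg
  have hmA : ∀ c : ℝ, MeasurableSet (D ⁻¹' {fun _ => c}) :=
    fun c => hD (measurableSet_singleton _)
  have hπ₁ne : π₁ ≠ 0 := (hζ.1.trans_le hπ₁ζ).ne'
  have hπ₀ne : π₀ ≠ 0 := (hζ.1.trans_le hπ₀ζ).ne'
  have hmeas : ∀ k : ℝ → (Fin p → ℝ) → (Fin q → ℝ) → ℝ,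
      Measurable (fun x : ℝ × (Fin p → ℝ) × (Fin q → ℝ) => k x.1 x.2.1 x.2.2) → ∀ c : ℝ,
      Measurable fun z : (Fin p → ℝ) × (Fin m → Fin p → ℝ) => k c z.1 (H (fun _ => c) z.2) :=
    fun k hk c => hk.comp (measurable_const.prodMk (measurable_fst.prodMk
      (hHmeas.comp (measurable_const.prodMk measurable_snd))))
  -- the increment `f - f*` and the baseline `f*` along a constant treatment path
  let δ : ℝ → Ω → ℝ := fun c ω =>
    f c (X ω) (H (fun _ => c) (Xm ω)) - fstar c (X ω) (H (fun _ => c) (Xm ω))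
  let b : ℝ → Ω → ℝ := fun c ω => fstar c (X ω) (H (fun _ => c) (Xm ω))
  let w : ℝ → ℝ → Ω → ℝ := fun c π ω =>
    (D ⁻¹' {fun _ => c}).indicator (fun _ => (1 : ℝ)) ω / π
  have hb₁ : Integrable (b 1) P := (hfL1 1 (.inr rfl)).2.2.2.1
  have hb₀ : Integrable (b 0) P := (hfL1 0 (.inl rfl)).2.2.2.2.1
  have hδ₁ : Integrable (δ 1) P := (hfL1 1 (.inr rfl)).1.sub hb₁
  have hδ₀ : Integrable (δ 0) P := (hfL1 0 (.inl rfl)).2.1.sub hb₀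
  have hw : ∀ c π (u : Ω → ℝ), Integrable u P → Integrable (fun ω => w c π ω * u ω) P :=
    fun c π u hu => hu.indicator_div_mul (hmA c) π
  have hwδ₁ : ∫ ω, w 1 π₁ ω * δ 1 ω ∂P = ∫ ω, δ 1 ω ∂P := by
    subst hπ₁
    exact integral_indicator_div_mul_of_indepFun hD hZ hindep (measurableSet_singleton _) hπ₁ne
      ((hmeas f hfmeas 1).sub (hmeas fstar hfstarmeas 1))
  have hwδ₀ : ∫ ω, w 0 π₀ ω * δ 0 ω ∂P = ∫ ω, δ 0 ω ∂P := by
    subst hπ₀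
    exact integral_indicator_div_mul_of_indepFun hD hZ hindep (measurableSet_singleton _) hπ₀ne
      ((hmeas f hfmeas 0).sub (hmeas fstar hfstarmeas 0))
  -- on the event that the treatment window is constant, the observed state is the constant-path one
  have hwobs : ∀ c π ω (k : ℝ → (Fin p → ℝ) → (Fin q → ℝ) → ℝ),
      w c π ω * k (D ω (Fin.last m)) (X ω) (Hobs ω)
        = w c π ω * k c (X ω) (H (fun _ => c) (Xm ω)) := by
    intro c π ω k
    by_cases hω : D ω = fun _ => c
    · simp [hHobs, hω]
    · simp [w, hω]
  let A : Ω → ℝ := fun ω => b 1 ω - b 0 ω +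
    (w 1 π₁ ω * (Y ω - b 1 ω) - w 0 π₀ ω * (Y ω - b 0 ω))
  let B : Ω → ℝ := fun ω => δ 1 ω - δ 0 ω - (w 1 π₁ ω * δ 1 ω - w 0 π₀ ω * δ 0 ω)
  have hA : Integrable A P := (hb₁.sub hb₀).add
    ((hw _ _ _ (hYint.sub hb₁)).sub (hw _ _ _ (hYint.sub hb₀)))
  have hB : Integrable B P := (hδ₁.sub hδ₀).sub ((hw _ _ _ hδ₁).sub (hw _ _ _ hδ₀))
  have hB0 : ∫ ω, B ω ∂P = 0 := by
    refine (integral_sub' (hδ₁.sub hδ₀) ((hw 1 π₁ _ hδ₁).sub (hw 0 π₀ _ hδ₀))).trans ?_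
    rw [integral_sub' hδ₁ hδ₀, integral_sub' (hw 1 π₁ _ hδ₁) (hw 0 π₀ _ hδ₀), hwδ₁, hwδ₀, sub_self]
  have hconst : g = fun _ => ∫ ω, A ω ∂P := by
    funext r
    have hAB : ∫ ω, (A ω + r * B ω) ∂P = ∫ ω, A ω ∂P := by
      rw [integral_add hA (hB.const_mul r), integral_const_mul, hB0, mul_zero, add_zero]
    rw [hg, ← hAB]
    refine integral_congr_ae (.of_forall fun ω => ?_)
    have e₁ := hwobs 1 π₁ ω fstar
    have e₂ := hwobs 0 π₀ ω fstar
    have e₃ := hwobs 1 π₁ ω f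
    have e₄ := hwobs 0 π₀ ω f
    simp only [A, B, b, δ, w] at e₁ e₂ e₃ e₄ ⊢
    linear_combination (r - 1) * e₁ - (r - 1) * e₂ - r * e₃ + r * e₄
  subst hconst
  simp
end
end
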